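/- Let σ(z) = 1/(1 + exp(−z)). Let g and β be real numbers with β > σ(g). Then (β − 1)·exp(g) + β > 0, and defining Δ = log((β − 1)·exp(g) + β), one has σ(g − Δ) = σ(g)/β, equivalently σ(g) = β·σ(g − Δ). -/

import Mathlib

/-- The standard logistic sigmoid. -/
noncomputable def sigmoid (z : ℝ) : ℝ := 1 / (1 + Real.exp (-z))

lemma sigmoid_eq_exp_div (z : ℝ) : sigmoid z = Real.exp z / (Real.exp z + 1) := by
  rw [sigmoid, Real.exp_neg]
  have := Real.exp_pos z
  field_simp

lemma sigmoid_sub_log (z : ℝ) {d : ℝ} (hd : 0 < d) :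
    sigmoid (z - Real.log d) = Real.exp z / (Real.exp z + d) := by
  rw [sigmoid_eq_exp_div, Real.exp_sub, Real.exp_log hd]
  have := Real.exp_pos z
  field_simp

/-- If `β > σ(g)` then `(β - 1) * exp(g) + β > 0`, and the calibration term
`Δ = log((β - 1) * exp(g) + β)` satisfies `σ(g - Δ) = σ(g) / β`, equivalently
`σ(g) = β * σ(g - Δ)`. -/
theorem imood_calibrated_logit (g β : ℝ) (hβ : sigmoid g < β) :
    0 < (β - 1) * Real.exp g + β ∧
    sigmoid (g - Real.log ((β - 1) * Real.exp g + β)) = sigmoid g / β ∧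
    sigmoid g = β * sigmoid (g - Real.log ((β - 1) * Real.exp g + β)) := by
  have hE1 : 0 < Real.exp g + 1 := by positivity
  have hσ := sigmoid_eq_exp_div g
  have hβ0 : 0 < β := lt_trans (by rw [hσ]; positivity) hβ
  have hd : 0 < (β - 1) * Real.exp g + β := by
    rw [hσ, div_lt_iff₀ hE1] at hβ
    linarith
  have key : sigmoid (g - Real.log ((β - 1) * Real.exp g + β)) = sigmoid g / β := by
    rw [sigmoid_sub_log g hd, hσ, div_div]
    congr 1
    ring
  exact ⟨hd, key, by rw [key, mul_div_cancel₀ _ hβ0.ne']⟩
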